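/- For 0 ≤ i ≤ n+1, the dual Bernstein polynomials of consecutive degrees satisfy D^{n+1}_i(x; α, β) = (1 - i/(n+1)) D^n_i(x; α, β) + (i/(n+1)) D^n_{i-1}(x; α, β) + C^{(α,β)}_{ni} R^{(α,β)}_{n+1}(x), where C^{(α,β)}_{ni} = (-1)^{n-i+1} (2n+σ+2)(σ+1)_n / (K (α+1)_{n-i+1} (β+1)_i), σ = α+β+1, K = Γ(α+1)Γ(β+1)/Γ(σ+1), and D^n_{-1} := D^n_{n+1} := 0. -/

import Mathlib

open scoped BigOperators
open MeasureTheory Polynomial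

/-- Pochhammer symbol `(c)_l = c (c+1) ⋯ (c+l-1)`. -/
noncomputable def poch (c : ℝ) (l : ℕ) : ℝ := ∏ j ∈ Finset.range l, (c + j)

/-- Shifted Jacobi polynomial `R_k^{(α,β)}(x)`. -/
noncomputable def jacobiR (α β : ℝ) (k : ℕ) (x : ℝ) : ℝ :=
  poch (α + 1) k / (Nat.factorial k) *
    ∑ l ∈ Finset.range (k + 1),
      poch (-(k : ℝ)) l * poch ((k : ℝ) + α + β + 1) l /
        (poch (α + 1) l * (Nat.factorial l)) * (1 - x) ^ l

/-- Hahn polynomial `Q_k(x; α, β; N)`. -/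
noncomputable def hahnQ (α β : ℝ) (N k : ℕ) (x : ℝ) : ℝ :=
  ∑ l ∈ Finset.range (k + 1),
    poch (-(k : ℝ)) l * poch ((k : ℝ) + α + β + 1) l * poch (-x) l /
      (poch (α + 1) l * poch (-(N : ℝ)) l * (Nat.factorial l))

/-- Bernstein basis polynomial `B^n_i(x)` as a real function. -/
noncomputable def bern (n i : ℕ) (x : ℝ) : ℝ :=
  (n.choose i : ℝ) * x ^ i * (1 - x) ^ (n - i)

/-- `D 0, …, D n` are the dual Bernstein polynomials of degree `n` with
parameters `α, β`: they have degree at most `n` and are biorthogonal to the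
Bernstein basis w.r.t. the weight `(1-x)^α x^β` on `[0,1]`. -/
def IsDualBernstein (n : ℕ) (α β : ℝ) (D : ℕ → Polynomial ℝ) : Prop :=
  (∀ j, j ≤ n → (D j).natDegree ≤ n) ∧
  ∀ i, i ≤ n → ∀ j, j ≤ n →
    (∫ x in (0:ℝ)..1, (1 - x) ^ α * x ^ β * bern n i x * (D j).eval x)
      = if i = j then (1:ℝ) else 0


lemma poch_zero (c : ℝ) : poch c 0 = 1 := by simp [poch]

lemma poch_succ (c : ℝ) (l : ℕ) : poch c (l+1) = poch c l * (c + l) := by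
  simp [poch, Finset.prod_range_succ]

lemma poch_add (c : ℝ) (a b : ℕ) : poch c (a+b) = poch c a * poch (c+a) b := by
  simp only [poch, Finset.prod_range_add]
  congr 1
  apply Finset.prod_congr rfl
  intro j _
  push_cast; ring

lemma poch_succ_left (c : ℝ) (l : ℕ) : poch c (l+1) = c * poch (c+1) l := by
  rw [add_comm l 1, poch_add]
  simp [poch]

lemma poch_pos {c : ℝ} (hc : 0 < c) (l : ℕ) : 0 < poch c l := by
  apply Finset.prod_pos
  intro j _
  positivity

lemma poch_ne {c : ℝ} (hc : 0 < c) (l : ℕ) : poch c l ≠ 0 := (poch_pos hc l).ne'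

lemma poch_one (m : ℕ) : poch 1 m = m.factorial := by
  induction m with
  | zero => simp [poch]
  | succ k ih => rw [poch_succ, ih, Nat.factorial_succ]; push_cast; ring

lemma poch_neg_nat (p l : ℕ) :
    poch (-(p:ℝ)) l = (-1)^l * (p.choose l : ℝ) * l.factorial := by
  have h : poch (-(p:ℝ)) l = (-1)^l * (p.descFactorial l : ℝ) := by
    induction l with
    | zero => simp [poch]
    | succ k ih =>
      rw [poch_succ, ih, Nat.descFactorial_succ]
      rcases le_or_gt k p with h | h
      · push_cast [h]; ring
      · rw [Nat.descFactorial_eq_zero_iff_lt.2 h]; simp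
  rw [h, Nat.descFactorial_eq_factorial_mul_choose]
  push_cast; ring

/-- reflection -/
lemma poch_reflect (b : ℝ) (k : ℕ) : poch (-(b + k)) k = (-1)^k * poch (b+1) k := by
  induction k generalizing b with
  | zero => simp [poch]
  | succ k ih =>
    rw [poch_succ, poch_succ_left (b+1)]
    have := ih (b+1)
    rw [show -(b + 1 + (k:ℝ)) = -(b + ((k+1 : ℕ):ℝ)) by push_cast; ring] at this
    rw [this]
    push_cast; ring

lemma alt_sum_succ (p : ℕ) (f : ℕ → ℝ) :
    ∑ l ∈ Finset.range (p+2), (-1)^l * ((p+1).choose l : ℝ) * f l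
      = ∑ l ∈ Finset.range (p+1), (-1)^l * (p.choose l : ℝ) * f l
        - ∑ l ∈ Finset.range (p+1), (-1)^l * (p.choose l : ℝ) * f (l+1) := by
  have := Finset.sum_choose_succ_mul (R := ℝ) (fun i _ => (-1)^i * f i) p
  have e : ∀ (q : ℕ) (g : ℕ → ℝ) (l : ℕ),
    (-1)^l * (q.choose l : ℝ) * g l = (q.choose l : ℝ) * ((-1)^l * g l) := by
    intros; ring
  simp only [e p f, e (p+1) f]
  rw [this, sub_eq_add_neg, ← Finset.sum_neg_distrib]
  congr 1
  apply Finset.sum_congr rfl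
  intros; ring

lemma chu (p : ℕ) (b c : ℝ) (hc : 0 < c) :
    ∑ l ∈ Finset.range (p+1), (-1)^l * (p.choose l : ℝ) * (poch b l / poch c l)
      = poch (c-b) p / poch c p := by
  induction p generalizing b c with
  | zero => simp [poch]
  | succ p ih =>
    rw [alt_sum_succ, ih b c hc]
    have h2 := ih (b+1) (c+1) (by linarith)
    have : ∑ l ∈ Finset.range (p+1), (-1)^l * (p.choose l : ℝ) * (poch b (l+1) / poch c (l+1))
      = (b/c) * (poch (c-b) p / poch (c+1) p) := by
      rw [show c - b = (c+1) - (b+1) by ring, ← h2, Finset.mul_sum]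
      apply Finset.sum_congr rfl
      intro l _
      rw [poch_succ_left, poch_succ_left]
      ring
    rw [this, poch_succ (c-b)]
    have e1 : poch c (p+1) = poch c p * (c+p) := poch_succ c p
    have e2 := poch_succ_left c p
    have n1 := poch_ne hc p
    have n2 := poch_ne (c := c+1) (by linarith) p
    have n3 : c + p ≠ 0 := by positivity
    have e3 : poch (c-b) p / poch c p = poch (c-b) p * (c+p) / poch c (p+1) := by
      rw [e1]; field_simp
    have e4 : b / c * (poch (c-b) p / poch (c+1) p) = poch (c-b) p * b / poch c (p+1) := by
      rw [e2]; field_simp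
    rw [e3, e4]; ring

lemma chu_ext (p M : ℕ) (hM : p ≤ M) (b c : ℝ) (hc : 0 < c) :
    ∑ l ∈ Finset.range (M+1), (-1)^l * (p.choose l : ℝ) * (poch b l / poch c l)
      = poch (c-b) p / poch c p := by
  rw [← chu p b c hc]
  symm
  apply Finset.sum_subset
  · intro l; simp; omega
  · intro l _ h
    simp at h
    rw [Nat.choose_eq_zero_of_lt (by omega)]; simp

-- integrals

lemma weight_int (α β : ℝ) (hα : α > -1) (hβ : β > -1) :
    IntervalIntegrable (fun x : ℝ => (1 - x) ^ α * x ^ β) volume 0 1 := by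
  have h := Complex.betaIntegral_convergent (u := ((β+1 : ℝ) : ℂ)) (v := ((α+1 : ℝ) : ℂ))
    (by simp; linarith) (by simp; linarith)
  have h2 : IntervalIntegrable (fun x : ℝ => (((1 - x) ^ α * x ^ β : ℝ) : ℂ)) volume 0 1 := by
    refine h.congr ?_
    intro x hx
    rw [Set.uIoc_of_le zero_le_one] at hx
    push_cast
    rw [Complex.ofReal_cpow (by linarith [hx.2]), Complex.ofReal_cpow hx.1.le]
    push_cast
    simp [mul_comm]
  rw [intervalIntegrable_iff] at h2 ⊢
  simpa [IntegrableOn] using h2.re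

lemma weight_beta (α β : ℝ) (hα : α > -1) (hβ : β > -1) :
    ∫ x in (0:ℝ)..1, (1 - x) ^ α * x ^ β
      = Real.Gamma (α+1) * Real.Gamma (β+1) / Real.Gamma (α+β+2) := by
  have h := ProbabilityTheory.beta_eq_betaIntegralReal (β+1) (α+1) (by linarith) (by linarith)
  have h2 : Complex.betaIntegral ((β+1 : ℝ) : ℂ) ((α+1 : ℝ) : ℂ)
     = ((∫ x in (0:ℝ)..1, (1 - x) ^ α * x ^ β : ℝ) : ℂ) := by
    rw [Complex.betaIntegral, ← intervalIntegral.integral_ofReal]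
    apply intervalIntegral.integral_congr
    intro x hx
    rw [Set.uIcc_of_le zero_le_one] at hx
    simp only
    push_cast
    rw [Complex.ofReal_cpow (by linarith [hx.2]), Complex.ofReal_cpow hx.1]
    push_cast
    simp [mul_comm]
  rw [h2, Complex.ofReal_re] at h
  rw [← h, ProbabilityTheory.beta, show β + 1 + (α+1) = α+β+2 by ring]
  ring

lemma weight_poly_int (α β : ℝ) (hα : α > -1) (hβ : β > -1) (p : ℝ[X]) :
    IntervalIntegrable (fun x : ℝ => (1 - x) ^ α * x ^ β * p.eval x) volume 0 1 :=
  (weight_int α β hα hβ).mul_continuousOn p.continuous.continuousOn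

noncomputable def Lw (α β : ℝ) (hα : α > -1) (hβ : β > -1) : ℝ[X] →ₗ[ℝ] ℝ where
  toFun p := ∫ x in (0:ℝ)..1, (1 - x) ^ α * x ^ β * p.eval x
  map_add' p q := by
    rw [← intervalIntegral.integral_add (weight_poly_int α β hα hβ p)
      (weight_poly_int α β hα hβ q)]
    congr 1; ext x; rw [eval_add]; ring
  map_smul' c p := by
    simp only [RingHom.id_apply, smul_eq_mul]
    rw [← intervalIntegral.integral_const_mul]
    congr 1; ext x; rw [eval_smul, smul_eq_mul]; ring

lemma Lw_apply (α β : ℝ) (hα : α > -1) (hβ : β > -1) (p : ℝ[X]) :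
    Lw α β hα hβ p = ∫ x in (0:ℝ)..1, (1 - x) ^ α * x ^ β * p.eval x := rfl

lemma Gamma_poch (c : ℝ) (hc : 0 < c) (l : ℕ) :
    Real.Gamma (c + l) = Real.Gamma c * poch c l := by
  induction l with
  | zero => simp [poch]
  | succ k ih =>
    rw [poch_succ, ← mul_assoc, ← ih, Nat.cast_succ, ← add_assoc,
      Real.Gamma_add_one (by positivity)]
    ring

lemma Lw_mono (α β : ℝ) (hα : α > -1) (hβ : β > -1) (a b : ℕ) :
    Lw α β hα hβ (X^a * (1-X)^b)
      = (Real.Gamma (α+1) * Real.Gamma (β+1) / Real.Gamma (α+β+2)) *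
        (poch (β+1) a * poch (α+1) b / (poch (α+β+2) a * poch (α+β+2+a) b)) := by
  have ha : (0:ℝ) ≤ a := by positivity
  have hb : (0:ℝ) ≤ b := by positivity
  have h := weight_beta (α+b) (β+a) (by linarith) (by linarith)
  rw [show α + b + 1 = (α+1) + b by ring, show β + a + 1 = (β+1)+a by ring,
    show α + b + (β + a) + 2 = (α+β+2) + ((a+b : ℕ):ℝ) by push_cast; ring,
    Gamma_poch _ (by linarith), Gamma_poch _ (by linarith), Gamma_poch _ (by linarith),
    poch_add] at h
  rw [Lw_apply]
  have e : ∫ x in (0:ℝ)..1, (1 - x) ^ α * x ^ β * (X^a * (1-X)^b : ℝ[X]).eval x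
    = ∫ x in (0:ℝ)..1, (1 - x) ^ (α+b) * x ^ (β+a) := by
    apply intervalIntegral.integral_congr_ae
    have : ∀ᵐ x : ℝ, x ≠ 1 := by
      simp [ae_iff]
    filter_upwards [this] with x hx1 hx
    rw [Set.uIoc_of_le zero_le_one] at hx
    have : 0 < 1 - x := by
      have := lt_of_le_of_ne hx.2 hx1
      linarith
    rw [Real.rpow_add this, Real.rpow_add hx.1, Real.rpow_natCast, Real.rpow_natCast]
    simp
    ring
  rw [e, h]
  ring

lemma Lw_sq (α β : ℝ) (hα : α > -1) (hβ : β > -1) (p : ℝ[X])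
    (h : Lw α β hα hβ (p * p) = 0) : p = 0 := by
  rw [Lw_apply, intervalIntegral.integral_eq_zero_iff_of_le_of_nonneg_ae zero_le_one _
    (weight_poly_int α β hα hβ _)] at h
  · by_contra hp
    have hf : ∀ᵐ x ∂(volume.restrict (Set.Ioc (0:ℝ) 1)), x ∉ ((p.roots.toFinset : Set ℝ) ∪ {1}) := by
      apply ae_restrict_of_ae
      rw [ae_iff]
      simp only [not_not]
      exact (Set.Finite.union (Finset.finite_toSet _) (Set.finite_singleton _)).measure_zero _
    have hF : ∀ᵐ x ∂(volume.restrict (Set.Ioc (0:ℝ) 1)), False := by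
      filter_upwards [h, hf, ae_restrict_mem measurableSet_Ioc] with x h1 h2 h3
      simp [hp] at h2
      have : 0 < 1 - x := by
        have := lt_of_le_of_ne h3.2 h2.1
        linarith
      have w1 := (Real.rpow_pos_of_pos this α).ne'
      have w2 := (Real.rpow_pos_of_pos h3.1 β).ne'
      simp [w1, w2, h2.2] at h1
    rw [ae_iff] at hF
    simp at hF
  · filter_upwards [ae_restrict_mem measurableSet_Ioc] with x h3
    have w1 := (Real.rpow_nonneg (by linarith [h3.2] : 0 ≤ 1 - x) α)
    have w2 := (Real.rpow_nonneg h3.1.le β)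
    rw [eval_mul]
    exact mul_nonneg (mul_nonneg w1 w2) (mul_self_nonneg _)

-- functional lemmas

lemma lead_lemma (Φ : ℝ[X] →ₗ[ℝ] ℝ) (m : ℕ) (h : ∀ s, s < m → Φ (X^s) = 0) (q : ℝ[X])
    (hq : q.natDegree ≤ m) : Φ q = q.coeff m * Φ (X^m) := by
  conv_lhs => rw [q.as_sum_range' (m+1) (by omega)]
  rw [map_sum, Finset.sum_range_succ, Finset.sum_eq_zero]
  · rw [← smul_X_eq_monomial, map_smul]; simp
  · intro s hs
    rw [← smul_X_eq_monomial, map_smul, h s (by simpa using hs)]; simp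

lemma kill_lemma (Φ : ℝ[X] →ₗ[ℝ] ℝ) (m : ℕ) (h : ∀ s, s ≤ m → Φ (X^s) = 0) (q : ℝ[X])
    (hq : q.natDegree ≤ m) : Φ q = 0 := by
  rw [lead_lemma Φ m (fun s hs => h s hs.le) q hq, h m le_rfl, mul_zero]

lemma bern_kill (Φ : ℝ[X] →ₗ[ℝ] ℝ) (n : ℕ)
    (h : ∀ j, j ≤ n → Φ (X^j * (1-X)^(n-j)) = 0) (s : ℕ) (hs : s ≤ n) : Φ (X^s) = 0 := by
  have e : (X^s : ℝ[X]) = ∑ k ∈ Finset.range (n-s+1),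
      ((n-s).choose k : ℝ) • (X^(s+k) * (1-X)^(n-(s+k))) := by
    have := add_pow (X : ℝ[X]) (1-X) (n-s)
    rw [add_sub_cancel, one_pow] at this
    conv_lhs => rw [← mul_one (X^s), this, Finset.mul_sum]
    apply Finset.sum_congr rfl
    intro k _
    rw [smul_eq_C_mul, Nat.sub_sub, pow_add]
    simp only [map_natCast]
    ring
  rw [e, map_sum]
  apply Finset.sum_eq_zero
  intro k hk
  simp at hk
  rw [map_smul, h _ (by omega), smul_zero]

lemma one_sub_pow_expand (m l : ℕ) (hl : l ≤ m) :
    ((1-X)^l : ℝ[X]) = ∑ k ∈ Finset.range (m+1),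
      ((m-l).choose k : ℝ) • (X^k * (1-X)^(m-k)) := by
  have := add_pow (X : ℝ[X]) (1-X) (m-l)
  rw [add_sub_cancel, one_pow] at this
  have h0 : ((1-X)^l : ℝ[X]) = (1-X)^l * ∑ k ∈ Finset.range (m-l+1),
      X^k * (1-X)^(m-l-k) * ((m-l).choose k : ℝ[X]) := by rw [← this, mul_one]
  rw [h0, Finset.mul_sum]
  have hsub : Finset.range (m-l+1) ⊆ Finset.range (m+1) := by
    intro k; simp; omega
  rw [← Finset.sum_subset hsub]
  · apply Finset.sum_congr rfl
    intro k hk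
    simp at hk
    rw [smul_eq_C_mul, show m - k = l + (m-l-k) by omega, pow_add]
    simp only [map_natCast]
    ring
  · intro k _ hk
    simp at hk
    rw [Nat.choose_eq_zero_of_lt (by omega)]; simp

lemma dual_val (n : ℕ) (α β : ℝ) (hα : α > -1) (hβ : β > -1) (D : ℕ → ℝ[X])
    (hD : IsDualBernstein n α β D) (k j : ℕ) (hk : k ≤ n) (hj : j ≤ n) :
    Lw α β hα hβ (X^k * (1-X)^(n-k) * D j) = if k = j then ((n.choose j : ℝ))⁻¹ else 0 := by
  have h := hD.2 k hk j hj
  have e : ∫ x in (0:ℝ)..1, (1 - x) ^ α * x ^ β * bern n k x * (D j).eval x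
      = (n.choose k : ℝ) * Lw α β hα hβ (X^k * (1-X)^(n-k) * D j) := by
    rw [Lw_apply, ← intervalIntegral.integral_const_mul]
    congr 1; ext x
    simp [bern]
    ring
  rw [e] at h
  have hc : (n.choose k : ℝ) ≠ 0 := by
    have := Nat.choose_pos hk
    positivity
  split_ifs with hkj
  · subst hkj
    rw [if_pos rfl] at h
    exact eq_inv_of_mul_eq_one_right h
  · rw [if_neg hkj] at h
    simpa [hc] using h

-- Jacobi polynomial

noncomputable def rc (α β : ℝ) (m l : ℕ) : ℝ :=
  poch (α+1) m / m.factorial *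
    ((-1)^l * (m.choose l : ℝ) * (poch ((m:ℝ)+α+β+1) l / poch (α+1) l))

noncomputable def Rp (α β : ℝ) (m : ℕ) : ℝ[X] :=
  ∑ l ∈ Finset.range (m+1), rc α β m l • (1-X)^l

lemma Rp_eval (α β : ℝ) (m : ℕ) (x : ℝ) : (Rp α β m).eval x = jacobiR α β m x := by
  rw [Rp, jacobiR, eval_finsetSum, Finset.mul_sum]
  apply Finset.sum_congr rfl
  intro l _
  rw [poch_neg_nat, rc]
  have : (l.factorial : ℝ) ≠ 0 := by positivity
  simp only [eval_smul, eval_pow, eval_sub, eval_one, eval_X, smul_eq_mul]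
  field_simp

lemma natDegree_one_sub : (1 - X : ℝ[X]).natDegree ≤ 1 := by
  compute_degree

lemma natDegree_one_sub_pow (l : ℕ) : ((1 - X)^l : ℝ[X]).natDegree ≤ l := by
  have := natDegree_pow_le_of_le l natDegree_one_sub
  simpa using this

lemma Rp_natDegree (α β : ℝ) (m : ℕ) : (Rp α β m).natDegree ≤ m := by
  apply natDegree_sum_le_of_forall_le
  intro l hl
  simp at hl
  exact (natDegree_smul_le _ _).trans ((natDegree_one_sub_pow l).trans (by omega))

lemma Rp_coeff (α β : ℝ) (hα : α > -1) (m : ℕ) :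
    (Rp α β m).coeff m = poch ((m:ℝ)+α+β+1) m / m.factorial := by
  rw [Rp, finsetSum_coeff, Finset.sum_range_succ, Finset.sum_eq_zero]
  · have := coeff_pow_of_natDegree_le (m := m) natDegree_one_sub
    rw [mul_one] at this
    rw [coeff_smul, this, rc]
    have h2 : (1 - X : ℝ[X]).coeff 1 = -1 := by simp [coeff_one]
    rw [h2]
    have := poch_ne (c := α+1) (by linarith) m
    have h3 : ((-1:ℝ)^m) * (-1)^m = 1 := by rw [← mul_pow]; simp
    simp only [Nat.choose_self, Nat.cast_one, smul_eq_mul, zero_add]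
    field_simp
    linear_combination (poch ((m:ℝ)+α+β+1) m) * h3
  · intro l hl
    simp at hl
    rw [coeff_smul, coeff_eq_zero_of_natDegree_lt ((natDegree_one_sub_pow l).trans_lt hl), smul_zero]

lemma Rp_X (α β : ℝ) (hα : α > -1) (hβ : β > -1) (m s : ℕ) :
    Lw α β hα hβ (X^s * Rp α β m) = poch (α+1) m / m.factorial *
      ((Real.Gamma (α+1) * Real.Gamma (β+1) / Real.Gamma (α+β+2)) *
        (poch (β+1) s / poch (α+β+2) s)) *
        (poch ((s:ℝ)+1-m) m / poch (α+β+2+s) m) := by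
  have hs : (0:ℝ) ≤ s := by positivity
  have h := chu m ((m:ℝ)+α+β+1) (α+β+2+s) (by linarith)
  rw [show α+β+2+s - ((m:ℝ)+α+β+1) = (s:ℝ)+1-m by ring] at h
  rw [← h, Rp, Finset.mul_sum, map_sum, Finset.mul_sum]
  apply Finset.sum_congr rfl
  intro l _
  rw [mul_smul_comm, map_smul, Lw_mono, rc, smul_eq_mul]
  have := poch_ne (c := α+1) (by linarith) l
  have := poch_ne (c := α+β+2) (by linarith) s
  have := poch_ne (c := α+β+2+s) (by linarith) l
  have : Real.Gamma (α+β+2) ≠ 0 := (Real.Gamma_pos_of_pos (by linarith)).ne'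
  field_simp

lemma Rp_orth (α β : ℝ) (hα : α > -1) (hβ : β > -1) (m s : ℕ) (hs : s < m) :
    Lw α β hα hβ (X^s * Rp α β m) = 0 := by
  rw [Rp_X]
  have : (s:ℝ)+1-m = -((m-1-s : ℕ):ℝ) := by
    rw [Nat.sub_sub, Nat.cast_sub (by omega)]; push_cast; ring
  rw [this, poch_neg_nat, Nat.choose_eq_zero_of_lt (by omega)]
  simp

noncomputable def Phi (α β : ℝ) (hα : α > -1) (hβ : β > -1) (g : ℝ[X]) : ℝ[X] →ₗ[ℝ] ℝ :=
  (Lw α β hα hβ).comp (LinearMap.mulRight ℝ g)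

lemma Phi_apply (α β : ℝ) (hα : α > -1) (hβ : β > -1) (g q : ℝ[X]) :
    Phi α β hα hβ g q = Lw α β hα hβ (q * g) := rfl

lemma Rp_norm (α β : ℝ) (hα : α > -1) (hβ : β > -1) (m : ℕ) :
    Lw α β hα hβ (Rp α β m * Rp α β m) =
      poch ((m:ℝ)+α+β+1) m / m.factorial * (poch (α+1) m *
      ((Real.Gamma (α+1) * Real.Gamma (β+1) / Real.Gamma (α+β+2)) *
        (poch (β+1) m / poch (α+β+2) (m + m)))) := by
  rw [← Phi_apply, lead_lemma _ m _ _ (Rp_natDegree α β m), Rp_coeff α β hα, Phi_apply, Rp_X]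
  · rw [show (m:ℝ) + 1 - m = 1 by ring, poch_one, poch_add]
    have : (m.factorial : ℝ) ≠ 0 := by positivity
    have hm : (0:ℝ) ≤ m := by positivity
    have := poch_ne (c := α+β+2) (by linarith) m
    have := poch_ne (c := α+β+2+m) (by linarith) m
    have : Real.Gamma (α+β+2) ≠ 0 := (Real.Gamma_pos_of_pos (by linarith)).ne'
    field_simp
  · intro s hs
    rw [Phi_apply, Rp_orth α β hα hβ m s hs]

lemma Rp_dual (m : ℕ) (α β : ℝ) (hα : α > -1) (hβ : β > -1) (D : ℕ → ℝ[X])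
    (hD : IsDualBernstein m α β D) (i : ℕ) (hi : i ≤ m) :
    Lw α β hα hβ (Rp α β m * D i) = poch (α+1) m / m.factorial *
      ((-1)^(m-i) * (poch (β+1) m / poch (β+1) i) / poch (α+1) (m-i)) := by
  have h := chu_ext (m-i) m (by omega) ((m:ℝ)+α+β+1) (α+1) (by linarith)
  have hr := poch_reflect (β+i) (m-i)
  rw [Nat.cast_sub hi] at hr
  have ha := poch_add (β+1) i (m-i)
  rw [Nat.add_sub_cancel' hi] at ha
  have n1 := poch_ne (c := β+1) (by linarith) i
  rw [show α+1 - ((m:ℝ)+α+β+1) = -(β+i+(m-i)) by ring, hr,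
    show β + (i:ℝ) + 1 = β + 1 + i by ring] at h
  have e : poch (β+1) m / poch (β+1) i = poch (β+1+i) (m-i) := by
    rw [ha]; field_simp
  rw [e, ← h, ← Phi_apply, Rp, map_sum, Finset.mul_sum]
  apply Finset.sum_congr rfl
  intro l hl
  simp at hl
  have hlm : l ≤ m := by omega
  rw [map_smul, one_sub_pow_expand m l hlm, map_sum]
  have e2 : ∑ k ∈ Finset.range (m+1), Phi α β hα hβ (D i)
      (((m-l).choose k : ℝ) • (X^k * (1-X)^(m-k))) = ((m-l).choose i : ℝ) * ((m.choose i : ℝ))⁻¹ := by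
    rw [Finset.sum_eq_single i]
    · rw [map_smul, Phi_apply, dual_val m α β hα hβ D hD i i hi hi, if_pos rfl, smul_eq_mul]
    · intro k hk hki
      simp at hk
      rw [map_smul, Phi_apply, dual_val m α β hα hβ D hD k i (by omega) hi, if_neg hki, smul_zero]
    · intro h; simp at h; omega
  rw [e2, rc, smul_eq_mul]
  have hc : (m.choose i : ℝ) ≠ 0 := by
    have := Nat.choose_pos hi
    positivity
  have e3 : (m.choose l : ℝ) * ((m-l).choose i) = (m.choose i) * ((m-i).choose l) := by
    rcases le_or_gt (l + i) m with hli | hli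
    · have h1 := Nat.choose_mul (n := m) (k := l+i) (s := l) (by omega)
      have h2 := Nat.choose_mul (n := m) (k := l+i) (s := i) (by omega)
      rw [Nat.add_sub_cancel_left] at h1
      rw [Nat.add_sub_cancel] at h2
      have h3 : (l+i).choose l = (l+i).choose i := Nat.choose_symm_add
      rw [← h3, h1] at h2
      exact_mod_cast h2
    · rw [Nat.choose_eq_zero_of_lt (by omega : m - l < i),
        Nat.choose_eq_zero_of_lt (by omega : m - i < l)]
      simp
  field_simp
  linear_combination (poch ((m:ℝ)+α+β+1) l * poch (α+1) m * (poch (α+1) l)⁻¹) * e3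

lemma E_part1 (n : ℕ) (α β : ℝ) (hα : α > -1) (hβ : β > -1) (E : ℕ → ℝ[X])
    (hE : IsDualBernstein n α β E) (i j : ℕ) (hi : i ≤ n+1) (hj : j ≤ n) :
    (1 - (i:ℝ)/((n:ℝ)+1)) * Lw α β hα hβ (X^j * (1-X)^(n-j) * E i)
      = if j = i then (((n+1).choose i : ℝ))⁻¹ else 0 := by
  rcases Nat.lt_or_ge n i with h | h
  · have : i = n+1 := by omega
    subst this
    rw [if_neg (by omega)]
    have : (n:ℝ)+1 ≠ 0 := by positivity
    push_cast
    rw [div_self this]; simp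
  · rw [dual_val n α β hα hβ E hE j i hj h]
    split_ifs with hji
    · have hc : (n.choose i : ℝ) ≠ 0 := by
        have := Nat.choose_pos h
        positivity
      have hcc : ((n+1).choose i : ℝ) ≠ 0 := by
        have := Nat.choose_pos hi
        positivity
      have e := Nat.choose_mul_succ_eq n i
      have eqq : (n.choose i : ℝ) * (n+1) = (n+1).choose i * ((n:ℝ)+1-i) := by
        have : ((n + 1 - i : ℕ):ℝ) = (n:ℝ)+1-i := by rw [Nat.cast_sub hi]; push_cast; ring
        rw [← this]; exact_mod_cast e
      have : (n:ℝ)+1 ≠ 0 := by positivity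
      field_simp
      linear_combination -eqq
    · simp

lemma E_part2 (n : ℕ) (α β : ℝ) (hα : α > -1) (hβ : β > -1) (E : ℕ → ℝ[X])
    (hE : IsDualBernstein n α β E) (i j : ℕ) (hi : i ≤ n+1) (hj : j ≤ n) :
    ((i:ℝ)/((n:ℝ)+1)) * Lw α β hα hβ (X^j * (1-X)^(n-j) * E (i-1))
      = if j + 1 = i then (((n+1).choose i : ℝ))⁻¹ else 0 := by
  rcases i with _ | i
  · simp
  · rw [Nat.add_sub_cancel, dual_val n α β hα hβ E hE j i hj (by omega)]
    simp only [Nat.add_right_cancel_iff]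
    split_ifs with hji
    · have hc : (n.choose i : ℝ) ≠ 0 := by
        have := Nat.choose_pos (show i ≤ n by omega)
        positivity
      have hcc : ((n+1).choose (i+1) : ℝ) ≠ 0 := by
        have := Nat.choose_pos hi
        positivity
      have eqq : ((n:ℝ)+1) * (n.choose i : ℝ) = (n+1).choose (i+1) * ((i:ℝ)+1) := by
        exact_mod_cast Nat.add_one_mul_choose_eq n i
      have : (n:ℝ)+1 ≠ 0 := by positivity
      push_cast
      field_simp
      linear_combination -eqq
    · simp

lemma const_id (n : ℕ) (α β : ℝ) (hα : α > -1) (hβ : β > -1) (i : ℕ) (K : ℝ) (hK : K ≠ 0) :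
    ((-1)^(n+1-i) * (2*(n:ℝ)+α+β+3) * poch (α+β+2) n /
            (K * poch (α+1) (n+1-i) * poch (β+1) i)) *
    (poch (((n+1:ℕ):ℝ)+α+β+1) (n+1) / (n+1).factorial * (poch (α+1) (n+1) *
      (K * (poch (β+1) (n+1) / poch (α+β+2) ((n+1) + (n+1))))))
    = poch (α+1) (n+1) / (n+1).factorial *
      ((-1)^(n+1-i) * (poch (β+1) (n+1) / poch (β+1) i) / poch (α+1) (n+1-i)) := by
  have hn : (0:ℝ) ≤ n := by positivity
  have e : poch (α+β+2) ((n+1)+(n+1)) =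
      poch (α+β+2) n * poch (((n+1:ℕ):ℝ)+α+β+1) (n+1) * (2*(n:ℝ)+α+β+3) := by
    rw [show (n+1)+(n+1) = (n + (n+1)) + 1 by ring, poch_succ, poch_add]
    push_cast
    rw [show (n:ℝ)+1+α+β+1 = α+β+2+n by ring]
    ring
  rw [e]
  have n1 := poch_ne (c := α+β+2) (by linarith) n
  have n2 := poch_ne (c := ((n+1:ℕ):ℝ)+α+β+1) (by push_cast; linarith) (n+1)
  have n3 : 2*(n:ℝ)+α+β+3 ≠ 0 := by
    have : 0 < 2*(n:ℝ)+α+β+3 := by linarith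
    exact this.ne'
  have n4 := poch_ne (c := α+1) (by linarith) (n+1-i)
  have n5 := poch_ne (c := β+1) (by linarith) i
  have n6 : ((n+1).factorial : ℝ) ≠ 0 := by positivity
  field_simp

/-- Degree-elevation recurrence connecting dual Bernstein polynomials of
degrees `n+1` and `n`. -/
theorem dualBernstein_degree_recurrence (n : ℕ) (α β : ℝ)
    (hα : α > -1) (hβ : β > -1)
    (D E : ℕ → Polynomial ℝ)
    (hD : IsDualBernstein (n+1) α β D) (hE : IsDualBernstein n α β E)
    (i : ℕ) (hi : i ≤ n+1) (x : ℝ) :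
    (D i).eval x
      = (1 - (i:ℝ)/((n:ℝ)+1)) * (E i).eval x
        + ((i:ℝ)/((n:ℝ)+1)) * (E (i-1)).eval x
        + ((-1)^(n+1-i) * (2*(n:ℝ)+α+β+3) * poch (α+β+2) n /
            ((Real.Gamma (α+1) * Real.Gamma (β+1) / Real.Gamma (α+β+2)) * poch (α+1) (n+1-i) * poch (β+1) i)) *
          jacobiR α β (n+1) x := by
  set K := Real.Gamma (α+1) * Real.Gamma (β+1) / Real.Gamma (α+β+2) with hKdef
  have hK : K ≠ 0 := by
    have h1 := Real.Gamma_pos_of_pos (show 0 < α+1 by linarith)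
    have h2 := Real.Gamma_pos_of_pos (show 0 < β+1 by linarith)
    have h3 := Real.Gamma_pos_of_pos (show 0 < α+β+2 by linarith)
    exact (div_pos (mul_pos h1 h2) h3).ne'
  have hcid := const_id n α β hα hβ i K hK
  set c := (-1)^(n+1-i) * (2*(n:ℝ)+α+β+3) * poch (α+β+2) n /
            (K * poch (α+1) (n+1-i) * poch (β+1) i) with hc
  set G : ℝ[X] := (1 - (i:ℝ)/((n:ℝ)+1)) • E i + ((i:ℝ)/((n:ℝ)+1)) • E (i-1) with hG
  have hGdeg : G.natDegree ≤ n := by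
    apply natDegree_add_le_of_degree_le
    · rcases Nat.lt_or_ge n i with h | h
      · have : i = n+1 := by omega
        have h0 : (1 - (i:ℝ)/((n:ℝ)+1)) = 0 := by
          rw [this]; push_cast
          rw [div_self (by positivity)]; simp
        rw [h0]; simp
      · exact (natDegree_smul_le _ _).trans (hE.1 i h)
    · exact (natDegree_smul_le _ _).trans (hE.1 (i-1) (by omega))
  set F : ℝ[X] := D i - G - c • Rp α β (n+1) with hF
  have hFdeg : F.natDegree ≤ n+1 := by
    have h1 := natDegree_sub_le_of_le (natDegree_sub_le_of_le (hD.1 i hi) hGdeg)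
      ((natDegree_smul_le c _).trans (Rp_natDegree α β (n+1)))
    exact h1.trans (by simp)
  have hFexp : ∀ q : ℝ[X], Phi α β hα hβ F q =
      Lw α β hα hβ (q * D i) - Lw α β hα hβ (q * G) - c * Lw α β hα hβ (q * Rp α β (n+1)) := by
    intro q
    rw [Phi_apply, hF, mul_sub, mul_sub, map_sub, map_sub, mul_smul_comm, map_smul, smul_eq_mul]
  have hRorth : ∀ q : ℝ[X], q.natDegree ≤ n → Lw α β hα hβ (q * Rp α β (n+1)) = 0 := by
    intro q hq
    exact kill_lemma (Phi α β hα hβ (Rp α β (n+1))) n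
      (fun s hs => Rp_orth α β hα hβ (n+1) s (by omega)) q hq
  have hFkill : ∀ s, s < n+1 → Phi α β hα hβ F (X^s) = 0 := by
    intro s hs
    apply bern_kill _ n _ s (by omega)
    intro j hj
    have hdeg : (X^j * (1-X)^(n-j) : ℝ[X]).natDegree ≤ n := by
      have := natDegree_mul_le_of_le (natDegree_X_pow_le (R := ℝ) j) (natDegree_one_sub_pow (n-j))
      exact this.trans (by omega)
    rw [hFexp, hRorth _ hdeg, hG, mul_add, map_add, mul_smul_comm, mul_smul_comm, map_smul,
      map_smul, smul_eq_mul, smul_eq_mul, E_part1 n α β hα hβ E hE i j hi hj,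
      E_part2 n α β hα hβ E hE i j hi hj]
    have e : (X^j * (1-X)^(n-j) : ℝ[X]) * D i = X^j * (1-X)^(n+1-j) * D i
        + X^(j+1) * (1-X)^(n+1-(j+1)) * D i := by
      rw [show n+1-j = (n-j)+1 by omega, show n+1-(j+1) = n-j by omega]
      ring
    rw [e, map_add, dual_val (n+1) α β hα hβ D hD j i (by omega) hi,
      dual_val (n+1) α β hα hβ D hD (j+1) i (by omega) hi]
    ring
  have hFR : Phi α β hα hβ F (Rp α β (n+1)) = 0 := by
    rw [hFexp, mul_comm _ G, hRorth G hGdeg, Rp_dual (n+1) α β hα hβ D hD i hi, Rp_norm,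
      ← hKdef, hcid]
    ring
  have hFX : Phi α β hα hβ F (X^(n+1)) = 0 := by
    rw [lead_lemma _ (n+1) hFkill _ (Rp_natDegree α β (n+1)), Rp_coeff α β hα] at hFR
    have hn : (0:ℝ) ≤ n := by positivity
    have n2 := poch_ne (c := ((n+1:ℕ):ℝ)+α+β+1) (by push_cast; linarith) (n+1)
    have n6 : ((n+1).factorial : ℝ) ≠ 0 := by positivity
    exact (mul_eq_zero.1 hFR).resolve_left (div_ne_zero n2 n6)
  have hF0 : F = 0 := by
    apply Lw_sq α β hα hβ
    rw [← Phi_apply, lead_lemma _ (n+1) hFkill _ hFdeg, hFX, mul_zero]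
  have := congrArg (eval x) hF0
  rw [hF, hG] at this
  simp only [eval_sub, eval_add, eval_smul, smul_eq_mul, Rp_eval, eval_zero] at this
  linarith
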